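/- arXiv:0807.4497 — 2 statements merged into one kernel-verified Lean document; each statement's English description precedes it below -/
import Mathlib

section
/- Let k ≥ 2, let a_1,…,a_k be nonnegative integers with at least one a_j strictly positive, and let (x_1,…,x_{k−1}) ∈ [0,1]^{k−1} be a point at which θ_s^k(x_s,…,x_{k−1}; a) ≥ 0 for every s = 1,…,k−1. Then a_1 + Σ_{s=1}^{k−1} a_{s+1}·w_{s,1}(x_1,…,x_s) > (1/3)·θ_1^k(x_1,…,x_{k−1}; a). -/
open Finset

/-- The 2×2 matrix `R(x)` with rows `(1−x, x)` and `(x, 1−x)`. -/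
noncomputable def Rm (x : ℝ) : Matrix (Fin 2) (Fin 2) ℝ := !![1 - x, x; x, 1 - x]

/-- The 2×2 matrix `T` with rows `(1, −1)` and `(0, 1)`. -/
noncomputable def Tm : Matrix (Fin 2) (Fin 2) ℝ := !![1, -1; 0, 1]

/-- Auxiliary product: `Maux x q n = R(x_{q+n})·T ⋯ R(x_q)·T`. -/
noncomputable def Maux (x : ℕ → ℝ) (q : ℕ) : ℕ → Matrix (Fin 2) (Fin 2) ℝ
  | 0 => Rm (x q) * Tm
  | n + 1 => Rm (x (q + n + 1)) * Tm * Maux x q n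

/-- `Mpq x p q = M_{p,q}(x_q,…,x_p) = R(x_p)·T·R(x_{p−1})·T ⋯ R(x_q)·T` (for `q ≤ p`). -/
noncomputable def Mpq (x : ℕ → ℝ) (p q : ℕ) : Matrix (Fin 2) (Fin 2) ℝ := Maux x q (p - q)

/-- `α_{p,q} = (M_{p,q})₂₂`. -/
noncomputable def alphaPQ (x : ℕ → ℝ) (p q : ℕ) : ℝ := Mpq x p q 1 1

/-- `β_{p,q} = (M_{p,q})₂₁`. -/
noncomputable def betaPQ (x : ℕ → ℝ) (p q : ℕ) : ℝ := Mpq x p q 1 0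

/-- `γ_{p,q} = (M_{p,q})₁₂`. -/
noncomputable def gammaPQ (x : ℕ → ℝ) (p q : ℕ) : ℝ := Mpq x p q 0 1

/-- `δ_{p,q} = (M_{p,q})₁₁`. -/
noncomputable def deltaPQ (x : ℕ → ℝ) (p q : ℕ) : ℝ := Mpq x p q 0 0

/-- `y_{p,q} = α_{p,q} − β_{p,q}`. -/
noncomputable def yPQ (x : ℕ → ℝ) (p q : ℕ) : ℝ := alphaPQ x p q - betaPQ x p q

/-- `w_{p,q} = α_{p,q} + β_{p,q}`. -/
noncomputable def wPQ (x : ℕ → ℝ) (p q : ℕ) : ℝ := alphaPQ x p q + betaPQ x p q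

/-- `θ_s^k(x_s,…,x_{k−1}; a) = a_s + Σ_{j=s}^{k−1} a_{j+1}·y_{j,s}`
(for `k = s` this is just `a_s`). -/
noncomputable def theta (x a : ℕ → ℝ) (k s : ℕ) : ℝ :=
  a s + ∑ j ∈ Finset.Icc s (k - 1), a (j + 1) * yPQ x j s

/-- Peeling the rightmost factor `R(x_q)·T` off the product. -/
lemma Maux_succ_right (x : ℕ → ℝ) (q n : ℕ) :
    Maux x q (n + 1) = Maux x (q + 1) n * (Rm (x q) * Tm) := by
  induction n with
  | zero => rfl
  | succ n ih =>
    rw [Maux, ih, Maux, Matrix.mul_assoc (Rm _ * Tm)]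
    congr 4
    ring

lemma Rm_mul_Tm (t : ℝ) : Rm t * Tm = !![1 - t, 2 * t - 1; t, 1 - 2 * t] := by
  ext i j
  fin_cases i <;> fin_cases j <;> simp [Rm, Tm, Matrix.mul_apply, Fin.sum_univ_two] <;> ring

/-- The `a`-weighted sum of the entries `β_{q,q}, …, β_{q+n-1,q}`. -/
noncomputable def betaSum (x a : ℕ → ℝ) (q n : ℕ) : ℝ :=
  ∑ i ∈ range n, a (q + i + 1) * Maux x q i 1 0

/-- `a_q` plus the `a`-weighted sum of the entries `α_{q,q}, …, α_{q+n-1,q}`. -/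
noncomputable def alphaSum (x a : ℕ → ℝ) (q n : ℕ) : ℝ :=
  a q + ∑ i ∈ range n, a (q + i + 1) * Maux x q i 1 1

lemma betaSum_succ (x a : ℕ → ℝ) (q n : ℕ) :
    betaSum x a q (n + 1) = betaSum x a (q + 1) n
      + x q * (alphaSum x a (q + 1) n - betaSum x a (q + 1) n) := by
  have h : ∀ i, a (q + (i + 1) + 1) * Maux x q (i + 1) 1 0
      = (1 - x q) * (a (q + 1 + i + 1) * Maux x (q + 1) i 1 0)
        + x q * (a (q + 1 + i + 1) * Maux x (q + 1) i 1 1) := fun i => by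
    rw [Maux_succ_right, Rm_mul_Tm, show q + (i + 1) + 1 = q + 1 + i + 1 by ring]
    simp [Matrix.mul_apply, Fin.sum_univ_two]
    ring
  rw [betaSum, sum_range_succ', sum_congr rfl fun i _ => h i, sum_add_distrib, ← mul_sum,
    ← mul_sum, betaSum, alphaSum, Maux, Rm_mul_Tm]
  simp
  ring

lemma alphaSum_succ (x a : ℕ → ℝ) (q n : ℕ) :
    alphaSum x a q (n + 1) = a q
      + (1 - 2 * x q) * (alphaSum x a (q + 1) n - betaSum x a (q + 1) n) := by
  have h : ∀ i, a (q + (i + 1) + 1) * Maux x q (i + 1) 1 1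
      = (2 * x q - 1) * (a (q + 1 + i + 1) * Maux x (q + 1) i 1 0)
        + (1 - 2 * x q) * (a (q + 1 + i + 1) * Maux x (q + 1) i 1 1) := fun i => by
    rw [Maux_succ_right, Rm_mul_Tm, show q + (i + 1) + 1 = q + 1 + i + 1 by ring]
    simp [Matrix.mul_apply, Fin.sum_univ_two]
    ring
  rw [alphaSum, sum_range_succ', sum_congr rfl fun i _ => h i, sum_add_distrib, ← mul_sum,
    ← mul_sum, betaSum, alphaSum, Maux, Rm_mul_Tm]
  simp
  ring

lemma sum_Icc_eq_sum_range {q n : ℕ} (hq : 1 ≤ q) (f : ℕ → ℝ) :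
    ∑ j ∈ Icc q (q + n - 1), f j = ∑ i ∈ range n, f (q + i) := by
  have h : Icc q (q + n - 1) = Ico q (q + n) := by
    ext j
    simp only [mem_Icc, mem_Ico]
    omega
  rw [h, sum_Ico_eq_sum_range, Nat.add_sub_cancel_left]

lemma theta_eq_alphaSum_sub_betaSum (x a : ℕ → ℝ) {q n : ℕ} (hq : 1 ≤ q) :
    theta x a (q + n) q = alphaSum x a q n - betaSum x a q n := by
  simp only [theta, sum_Icc_eq_sum_range hq, alphaSum, betaSum, yPQ, alphaPQ, betaPQ, Mpq,
    Nat.add_sub_cancel_left, mul_sub, sum_sub_distrib]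
  ring

lemma sum_wPQ_eq_alphaSum_add_betaSum (x a : ℕ → ℝ) {q n : ℕ} (hq : 1 ≤ q) :
    a q + ∑ s ∈ Icc q (q + n - 1), a (s + 1) * wPQ x s q
      = alphaSum x a q n + betaSum x a q n := by
  simp only [sum_Icc_eq_sum_range hq, alphaSum, betaSum, wPQ, alphaPQ, betaPQ, Mpq,
    Nat.add_sub_cancel_left, mul_add, sum_add_distrib]
  ring

/-- Nonnegativity of every `θ` makes `betaSum` nonnegative, and `alphaSum + 2 * betaSum`
positive as soon as the weight does not vanish. -/
lemma betaSum_nonneg_and_alphaSum_pos (x a : ℕ → ℝ) (ha : ∀ j, 0 ≤ a j) (n : ℕ) :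
    ∀ q, (∀ i, q ≤ i → i < q + n → 0 ≤ x i) →
      (∀ i m, i + m = n → 0 ≤ alphaSum x a (q + i) m - betaSum x a (q + i) m) →
      0 ≤ betaSum x a q n ∧
        ((∃ j, q ≤ j ∧ j ≤ q + n ∧ 0 < a j) → 0 < alphaSum x a q n + 2 * betaSum x a q n) := by
  induction n with
  | zero =>
    rintro q - -
    refine ⟨by simp [betaSum], ?_⟩
    rintro ⟨j, hj, hj', hpos⟩
    obtain rfl : j = q := by omega
    simpa [alphaSum, betaSum] using hpos
  | succ n ih =>
    intro q hx hθ
    obtain ⟨hB, hpos⟩ := ih (q + 1) (fun i hi hi' => hx i (by omega) (by omega))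
      (fun i m him => by simpa [add_assoc, add_comm 1 i] using hθ (i + 1) m (by omega))
    have hθ' := hθ 1 n (by omega)
    have hxq := mul_nonneg (hx q le_rfl (by omega)) hθ'
    rw [betaSum_succ, alphaSum_succ]
    refine ⟨by linarith, ?_⟩
    rintro ⟨j, hj, hj', hj''⟩
    have haq := ha q
    rcases hj.eq_or_lt with rfl | hlt
    · linarith
    · have := hpos ⟨j, hlt, by omega, hj''⟩
      linarith

/-- The trace term strictly dominates one third of the first vertical eigenvalue. -/
theorem stmt3 (k : ℕ) (hk : 2 ≤ k) (a : ℕ → ℕ)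
    (ha : ∃ j, 1 ≤ j ∧ j ≤ k ∧ 0 < a j)
    (x : ℕ → ℝ) (hx : ∀ i, 1 ≤ i → i ≤ k - 1 → x i ∈ Set.Icc (0 : ℝ) 1)
    (hθ : ∀ s, 1 ≤ s → s ≤ k - 1 → 0 ≤ theta x (fun j => (a j : ℝ)) k s) :
    (1 / 3) * theta x (fun j => (a j : ℝ)) k 1
      < (a 1 : ℝ) + ∑ s ∈ Finset.Icc 1 (k - 1), (a (s + 1) : ℝ) * wPQ x s 1 := by
  obtain ⟨n, rfl⟩ : ∃ n, k = 1 + n := ⟨k - 1, by omega⟩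
  set b : ℕ → ℝ := fun j => (a j : ℝ) with hb
  obtain ⟨-, hpos⟩ := betaSum_nonneg_and_alphaSum_pos x b (fun j => Nat.cast_nonneg _) n 1
    (fun i hi hi' => (hx i hi (by omega)).1) (fun i m him => by
      rcases m.eq_zero_or_pos with rfl | hm
      · simp [alphaSum, betaSum, hb]
      · have h := hθ (1 + i) (by omega) (by omega)
        rwa [show 1 + n = 1 + i + m by omega,
          theta_eq_alphaSum_sub_betaSum x b (by omega)] at h)
  obtain ⟨j, hj, hj', hj''⟩ := ha
  have h := hpos ⟨j, hj, hj', Nat.cast_pos.mpr hj''⟩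
  have hw := sum_wPQ_eq_alphaSum_add_betaSum x b (q := 1) (n := n) le_rfl
  rw [theta_eq_alphaSum_sub_betaSum x b le_rfl]
  change _ < b 1 + ∑ s ∈ Icc 1 (1 + n - 1), b (s + 1) * wPQ x s 1
  rw [hw]
  linarith
end

section
/- Let k ≥ 2, let a = (a_1,…,a_k) ∈ ℝ^k, and let x_1,…,x_{k−2} be arbitrary real numbers. Then θ_1^k(x_1,…,x_{k−2},1; a) = θ_1^{k−1}(x_1,…,x_{k−2}; b), where b = (a_1−a_k, a_2−a_k, …, a_{k−2}−a_k, a_{k−1}−2a_k) ∈ ℝ^{k−1} (for k = 2 this reads θ_1^2(1; a) = a_1 − 2a_2). -/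
open Finset

lemma Mpq_self (x : ℕ → ℝ) (q : ℕ) : Mpq x q q = Rm (x q) * Tm := by
  simp [Mpq, Maux]

lemma Mpq_succ (x : ℕ → ℝ) {p q : ℕ} (h : q ≤ p) :
    Mpq x (p + 1) q = Rm (x (p + 1)) * Tm * Mpq x p q := by
  obtain ⟨n, rfl⟩ := Nat.exists_eq_add_of_le h
  simp [Mpq, Nat.add_assoc, Maux]

lemma yPQ_self (x : ℕ → ℝ) (q : ℕ) : yPQ x q q = 1 - 3 * x q := by
  simp [yPQ, alphaPQ, betaPQ, Mpq_self, Rm, Tm]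
  ring

lemma yPQ_succ (x : ℕ → ℝ) {p q : ℕ} (h : q ≤ p) :
    yPQ x (p + 1) q
      = x (p + 1) * (gammaPQ x p q - deltaPQ x p q) + (1 - 2 * x (p + 1)) * yPQ x p q := by
  simp [yPQ, alphaPQ, betaPQ, gammaPQ, deltaPQ, Mpq_succ x h, Rm, Tm, Matrix.mul_apply,
    Fin.sum_univ_two]
  ring

lemma gammaPQ_sub_deltaPQ_succ (x : ℕ → ℝ) {p q : ℕ} (h : q ≤ p) :
    gammaPQ x (p + 1) q - deltaPQ x (p + 1) q
      = gammaPQ x p q - deltaPQ x p q - yPQ x (p + 1) q := by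
  simp [yPQ, alphaPQ, betaPQ, gammaPQ, deltaPQ, Mpq_succ x h, Rm, Tm, Matrix.mul_apply,
    Fin.sum_univ_two]
  ring

lemma gammaPQ_sub_deltaPQ (x : ℕ → ℝ) {p q : ℕ} (h : q ≤ p) :
    gammaPQ x p q - deltaPQ x p q = -1 - ∑ j ∈ Finset.Icc q p, yPQ x j q := by
  induction p, h using Nat.le_induction with
  | base =>
    simp [yPQ_self, gammaPQ, deltaPQ, Mpq_self, Rm, Tm]
    ring
  | succ p h ih =>
    rw [gammaPQ_sub_deltaPQ_succ x h, ih, Finset.sum_Icc_succ_top (by omega)]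
    ring

/-- When the last variable is `1`, the last `y` is determined by the preceding ones. -/
lemma yPQ_succ_of_eq_one (x : ℕ → ℝ) {p q : ℕ} (h : q ≤ p) (hx : x (p + 1) = 1) :
    yPQ x (p + 1) q = -1 - ∑ j ∈ Finset.Icc q p, yPQ x j q - yPQ x p q := by
  rw [yPQ_succ x h, gammaPQ_sub_deltaPQ x h, hx]
  ring

/-- Specialization at `x_{k−1} = 1`:
`θ_1^k(x_1,…,x_{k−2},1; a) = θ_1^{k−1}(x_1,…,x_{k−2}; b)` with
`b = (a_1−a_k,…,a_{k−2}−a_k, a_{k−1}−2a_k)`. -/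
theorem stmt12 (k : ℕ) (hk : 2 ≤ k) (a x : ℕ → ℝ) (hx : x (k - 1) = 1) :
    theta x a k 1
      = theta x (fun j => if j = k - 1 then a (k - 1) - 2 * a k else a j - a k) (k - 1) 1 := by
  obtain ⟨m, rfl⟩ := Nat.exists_eq_add_of_le' hk
  rcases m with _ | m
  · have h : x 1 = 1 := hx
    simp [theta, yPQ_self, h]
    ring
  · have h : x (m + 1 + 1) = 1 := hx
    have hsum : ∑ j ∈ Finset.Icc 1 m, (if j = m + 1 then a (m + 2) - 2 * a (m + 3)
          else a (j + 1) - a (m + 3)) * yPQ x j 1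
        = ∑ j ∈ Finset.Icc 1 m, a (j + 1) * yPQ x j 1
          - a (m + 3) * ∑ j ∈ Finset.Icc 1 m, yPQ x j 1 := by
      rw [Finset.mul_sum, ← Finset.sum_sub_distrib]
      refine Finset.sum_congr rfl fun j hj => ?_
      rw [if_neg (by have := Finset.mem_Icc.mp hj; omega)]
      ring
    simp [-ite_mul, theta, Finset.sum_Icc_succ_top, yPQ_succ_of_eq_one x (Nat.le_add_left 1 m) h,
      hsum]
    ring
end
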